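/- arXiv:1812.07725 — 4 statements merged into one kernel-verified Lean document; each statement's English description precedes it below -/
import Mathlib

section
/- Let 𝕃 be a d×d real symmetric matrix (d ≥ 2) whose eigenvalues satisfy μ₁ < 0 < μ₂ < ⋯ < μ_d, let J be a d×d real antisymmetric matrix and A_J := I + J. Suppose μ > 0 and u ∈ ℂ^d with u ≠ 0 satisfy A_J𝕃u = −μu. Then μ ≥ −μ₁. Moreover, μ = −μ₁ if and only if u is an eigenvector of 𝕃 for the eigenvalue μ₁ and Ju = 0. -/
set_option autoImplicit false

open Matrix

noncomputable section

lemma aux_skew {n : ℕ} (J : Matrix (Fin n) (Fin n) ℝ) (hJ : Jᵀ = -J) (y : Fin n → ℝ) :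
    y ⬝ᵥ (J *ᵥ y) = 0 := by
  have h : y ⬝ᵥ (J *ᵥ y) = - (y ⬝ᵥ (J *ᵥ y)) := by
    conv_lhs => rw [dotProduct_mulVec, ← mulVec_transpose, hJ, neg_mulVec, neg_dotProduct,
      dotProduct_comm]
  linarith

lemma aux_key {n : ℕ} (L J : Matrix (Fin n) (Fin n) ℝ) (hL : L.IsSymm) (hJ : Jᵀ = -J)
    (m μ : ℝ) (hm : m < 0) (hμ : 0 < μ) (hle : μ ≤ -m)
    (hs : ∀ l ∈ spectrum ℝ L, l = m ∨ 0 < l)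
    (x : Fin n → ℝ) (hx : L *ᵥ x + J *ᵥ (L *ᵥ x) = (-μ) • x) :
    L *ᵥ x = m • x := by
  have hH : L.IsHermitian := by
    rw [Matrix.IsHermitian, conjTranspose_eq_transpose_of_trivial]; exact hL
  let b := hH.eigenvectorBasis
  have hin : ∀ i (y : Fin n → ℝ), inner ℝ (b i) (WithLp.toLp 2 y) = (b i).ofLp ⬝ᵥ y := by
    intro i y
    simp [EuclideanSpace.inner_eq_star_dotProduct, dotProduct_comm]
  have hLc : ∀ i, (b i).ofLp ⬝ᵥ (L *ᵥ x) = hH.eigenvalues i * ((b i).ofLp ⬝ᵥ x) := by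
    intro i
    have h1 := hH.mulVec_eigenvectorBasis i
    rw [dotProduct_mulVec, ← mulVec_transpose, hL.eq]
    change (L *ᵥ (b i).ofLp) ⬝ᵥ x = _
    rw [h1, smul_dotProduct, smul_eq_mul]
  have hpar : ∀ y z : Fin n → ℝ, y ⬝ᵥ z = ∑ i, ((b i).ofLp ⬝ᵥ y) * ((b i).ofLp ⬝ᵥ z) := by
    intro y z
    have h := b.sum_inner_mul_inner (WithLp.toLp 2 y) (WithLp.toLp 2 z)
    have h2 : inner ℝ (WithLp.toLp 2 y) (WithLp.toLp 2 z) = y ⬝ᵥ z := by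
      simp [EuclideanSpace.inner_eq_star_dotProduct, dotProduct_comm]
    rw [← h2, ← h]
    refine Finset.sum_congr rfl fun i _ => ?_
    rw [real_inner_comm, hin, hin]
  have e1 : (L *ᵥ x) ⬝ᵥ (L *ᵥ x) = -μ * ((L *ᵥ x) ⬝ᵥ x) := by
    have := congrArg (fun w => (L *ᵥ x) ⬝ᵥ w) hx
    simp only [dotProduct_add, aux_skew J hJ, dotProduct_smul, smul_eq_mul, add_zero] at this
    exact this
  rw [hpar, hpar (L *ᵥ x) x] at e1
  have e2 : ∑ i, hH.eigenvalues i * (hH.eigenvalues i + μ) * ((b i).ofLp ⬝ᵥ x)^2 = 0 := by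
    rw [Finset.mul_sum, ← sub_eq_zero, ← Finset.sum_sub_distrib] at e1
    rw [← e1]
    refine Finset.sum_congr rfl fun i _ => ?_
    rw [hLc]; ring
  have hev : ∀ i, hH.eigenvalues i = m ∨ 0 < hH.eigenvalues i :=
    fun i => hs _ (hH.eigenvalues_mem_spectrum_real i)
  have e3 := (Finset.sum_eq_zero_iff_of_nonneg (fun i _ => by
    refine mul_nonneg ?_ (sq_nonneg _)
    rcases hev i with h | h
    · rw [h]; nlinarith
    · positivity)).1 e2
  have e4 : ∀ i, (b i).ofLp ⬝ᵥ (L *ᵥ x) = (b i).ofLp ⬝ᵥ (m • x) := by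
    intro i
    rw [hLc, dotProduct_smul, smul_eq_mul]
    rcases hev i with h | h
    · rw [h]
    · have h5 := e3 i (Finset.mem_univ i)
      have h6 : hH.eigenvalues i * (hH.eigenvalues i + μ) ≠ 0 := by positivity
      have h7 : (b i).ofLp ⬝ᵥ x = 0 := by simpa [h6] using h5
      rw [h7]; simp
  have e5 : (L *ᵥ x - m • x) ⬝ᵥ (L *ᵥ x - m • x) = 0 := by
    rw [hpar]
    exact Finset.sum_eq_zero fun i _ => by rw [dotProduct_sub, e4]; simp
  exact sub_eq_zero.1 (dotProduct_self_eq_zero.1 e5)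

lemma aux_split {n : ℕ} (M : Matrix (Fin n) (Fin n) ℝ) (c : ℝ) (u : Fin n → ℂ) :
    (M.map (algebraMap ℝ ℂ)) *ᵥ u = (c : ℂ) • u ↔
      (M *ᵥ (fun i => (u i).re) = c • (fun i => (u i).re) ∧
       M *ᵥ (fun i => (u i).im) = c • (fun i => (u i).im)) := by
  simp only [funext_iff, Complex.ext_iff, mulVec, dotProduct, Matrix.map_apply, Pi.smul_apply,
    smul_eq_mul, Complex.re_sum, Complex.im_sum, Complex.coe_algebraMap, Complex.re_ofReal_mul,
    Complex.im_ofReal_mul, forall_and]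

lemma aux_real {n : ℕ} (L J : Matrix (Fin n) (Fin n) ℝ) (hJ : Jᵀ = -J)
    (m μ : ℝ) (hm : m < 0)
    (x : Fin n → ℝ) (hx : L *ᵥ x + J *ᵥ (L *ᵥ x) = (-μ) • x) (h : L *ᵥ x = m • x) :
    (x ≠ 0 → μ = -m) ∧ (μ = -m → J *ᵥ x = 0) := by
  rw [h, mulVec_smul] at hx
  constructor
  · intro hx0
    have := congrArg (fun w => x ⬝ᵥ w) hx
    simp only [dotProduct_add, dotProduct_smul, aux_skew J hJ, smul_eq_mul] at this
    have h0 : x ⬝ᵥ x ≠ 0 := fun h => hx0 (dotProduct_self_eq_zero.1 h)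
    have : (m + μ) * (x ⬝ᵥ x) = 0 := by linarith
    have := (mul_eq_zero.1 this).resolve_right h0
    linarith
  · rintro rfl
    rw [neg_neg, add_eq_left] at hx
    exact (smul_eq_zero.1 hx).resolve_left hm.ne

/-- For the non-reversible drift, the unique negative eigenvalue of
`A_J𝕃` dominates (in magnitude) the negative eigenvalue of `𝕃`, with equality iff the
eigenvector of `𝕃` for `μ₁` is killed by `J`.  (Matrices are `(d+2)×(d+2)`, i.e. the
dimension is at least 2.) -/
theorem nonreversible_saddle_eigenvalue_compare
    {d : ℕ}
    (L : Matrix (Fin (d + 2)) (Fin (d + 2)) ℝ) (hL : L.IsSymm)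
    -- the eigenvalues of L are μ₁ < 0 < μ₂ < ⋯ < μ_d
    (μvec : Fin (d + 2) → ℝ) (hmono : StrictMono μvec)
    (hneg : μvec 0 < 0) (hpos : 0 < μvec 1)
    (hspec : spectrum ℝ L = Set.range μvec)
    -- J antisymmetric, A_J = I + J
    (J : Matrix (Fin (d + 2)) (Fin (d + 2)) ℝ) (hJ : Jᵀ = -J)
    (AJ : Matrix (Fin (d + 2)) (Fin (d + 2)) ℝ) (hAJ : AJ = 1 + J)
    -- A_J 𝕃 u = -μ u with μ > 0 and u ≠ 0 (over ℂ)
    (μ : ℝ) (hμ : 0 < μ)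
    (u : Fin (d + 2) → ℂ) (hu : u ≠ 0)
    (heig : ((AJ * L).map (algebraMap ℝ ℂ)) *ᵥ u = ((-μ : ℝ) : ℂ) • u) :
    -μvec 0 ≤ μ ∧
      (μ = -μvec 0 ↔
        ((L.map (algebraMap ℝ ℂ)) *ᵥ u = ((μvec 0 : ℝ) : ℂ) • u ∧
          (J.map (algebraMap ℝ ℂ)) *ᵥ u = 0)) := by
  subst hAJ
  have hs : ∀ l ∈ spectrum ℝ L, l = μvec 0 ∨ 0 < l := by
    intro l hl
    rw [hspec] at hl
    obtain ⟨i, rfl⟩ := hl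
    by_cases hi : i = 0
    · left; rw [hi]
    · right
      refine hpos.trans_le (hmono.monotone ?_)
      rw [Fin.le_def]
      have : i.val ≠ 0 := fun h => hi (Fin.ext h)
      simp only [Fin.val_one]
      omega
  rw [aux_split] at heig
  have hz := aux_split J 0 u
  simp only [Complex.ofReal_zero, zero_smul] at hz
  rw [aux_split, hz]
  simp only [add_mul, one_mul, add_mulVec, ← mulVec_mulVec] at heig
  obtain ⟨ha, hb⟩ := heig
  have hne : (fun i => (u i).re) ≠ 0 ∨ (fun i => (u i).im) ≠ 0 := by
    by_contra hcon
    push Not at hcon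
    exact hu (funext fun i => Complex.ext (congrFun hcon.1 i) (congrFun hcon.2 i))
  have hconc : ∀ (_ : L *ᵥ (fun i => (u i).re) = μvec 0 • (fun i => (u i).re))
      (_ : L *ᵥ (fun i => (u i).im) = μvec 0 • (fun i => (u i).im)), μ = -μvec 0 := by
    intro h1 h2
    rcases hne with h | h
    · exact (aux_real L J hJ _ μ hneg _ ha h1).1 h
    · exact (aux_real L J hJ _ μ hneg _ hb h2).1 h
  refine ⟨?_, ?_, ?_⟩
  · by_contra hlt
    have hle : μ ≤ -μvec 0 := by linarith
    have := hconc (aux_key L J hL hJ _ μ hneg hμ hle hs _ ha)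
      (aux_key L J hL hJ _ μ hneg hμ hle hs _ hb)
    linarith
  · intro he
    have h1 := aux_key L J hL hJ _ μ hneg hμ he.le hs _ ha
    have h2 := aux_key L J hL hJ _ μ hneg hμ he.le hs _ hb
    exact ⟨⟨h1, h2⟩, (aux_real L J hJ _ μ hneg _ ha h1).2 he,
      (aux_real L J hJ _ μ hneg _ hb h2).2 he⟩
  · rintro ⟨⟨h1, h2⟩, _⟩
    exact hconc h1 h2

end
end

section
/- Let 𝕃 be a d×d real symmetric matrix (d ≥ 2) whose eigenvalues satisfy μ₁ < 0 < μ₂ < ⋯ < μ_d, let S be a real orthogonal matrix and D := diag(μ₁,…,μ_d) with 𝕃 = SᵀDS, let J be a d×d real antisymmetric matrix and A_J := I + J. Suppose μ > 0 and u ∈ ℂ^d with u ≠ 0 satisfy A_J𝕃u = −μu. Then u*𝕃u < 0, the first component (Su)₁ of Su is nonzero, and μ = (Σ_{i=1}^d μ_i²·|(Su)_i|²) / (Σ_{i=1}^d (−μ_i)·|(Su)_i|²). -/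
set_option autoImplicit false

open Matrix

noncomputable section

/-- Rayleigh-quotient formula for the negative eigenvalue of `A_J𝕃`.
(Matrices are `(d+2)×(d+2)`, i.e. the dimension is at least 2.) -/
theorem nonreversible_saddle_eigenvalue_formula
    {d : ℕ}
    (L : Matrix (Fin (d + 2)) (Fin (d + 2)) ℝ) (hL : L.IsSymm)
    -- the eigenvalues of L are μ₁ < 0 < μ₂ < ⋯ < μ_d
    (μvec : Fin (d + 2) → ℝ) (hmono : StrictMono μvec)
    (hneg : μvec 0 < 0) (hpos : 0 < μvec 1)
    -- S orthogonal with 𝕃 = Sᵀ D S, D = diag(μ₁,…,μ_d)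
    (S : Matrix (Fin (d + 2)) (Fin (d + 2)) ℝ) (hS : Sᵀ * S = 1)
    (hLdecomp : L = Sᵀ * Matrix.diagonal μvec * S)
    -- J antisymmetric, A_J = I + J
    (J : Matrix (Fin (d + 2)) (Fin (d + 2)) ℝ) (hJ : Jᵀ = -J)
    (AJ : Matrix (Fin (d + 2)) (Fin (d + 2)) ℝ) (hAJ : AJ = 1 + J)
    -- A_J 𝕃 u = -μ u with μ > 0 and u ≠ 0 (over ℂ)
    (μ : ℝ) (hμ : 0 < μ)
    (u : Fin (d + 2) → ℂ) (hu : u ≠ 0)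
    (heig : ((AJ * L).map (algebraMap ℝ ℂ)) *ᵥ u = ((-μ : ℝ) : ℂ) • u) :
    -- u*𝕃u is real and negative
    ((star u) ⬝ᵥ ((L.map (algebraMap ℝ ℂ)) *ᵥ u)).im = 0 ∧
    ((star u) ⬝ᵥ ((L.map (algebraMap ℝ ℂ)) *ᵥ u)).re < 0 ∧
    -- the first component of Su is nonzero
    ((S.map (algebraMap ℝ ℂ)) *ᵥ u) 0 ≠ 0 ∧
    -- Rayleigh-quotient formula for μ
    μ = (∑ i, μvec i ^ 2 * Complex.normSq (((S.map (algebraMap ℝ ℂ)) *ᵥ u) i)) /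
        (∑ i, (-μvec i) * Complex.normSq (((S.map (algebraMap ℝ ℂ)) *ᵥ u) i)) := by
  have hS' : S * Sᵀ = 1 := mul_eq_one_comm.mp hS
  set f := algebraMap ℝ ℂ with hf
  have hct : ∀ M : Matrix (Fin (d + 2)) (Fin (d + 2)) ℝ, (M.map f)ᴴ = Mᵀ.map f := by
    intro M
    ext i j
    simp [hf]
  set w := (S.map f) *ᵥ u with hw
  set v : Fin (d + 2) → ℂ := (diagonal μvec).map f *ᵥ w with hv
  set z := (L.map f) *ᵥ u with hz
  have hvi : ∀ i, v i = (μvec i : ℂ) * w i := by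
    intro i
    rw [hv, Matrix.diagonal_map (by simp [hf]), Matrix.mulVec_diagonal]
    simp [hf]
  have hzv : z = (S.map f)ᴴ *ᵥ v := by
    rw [hz, hLdecomp, Matrix.map_mul, Matrix.map_mul, hct, hv, hw]
    simp only [Matrix.mulVec_mulVec, Matrix.mul_assoc]
  have huw : u = (S.map f)ᴴ *ᵥ w := by
    rw [hct, hw, Matrix.mulVec_mulVec, ← Matrix.map_mul, hS]
    simp
  have hSS : (S.map f) * (S.map f)ᴴ = 1 := by
    rw [hct, ← Matrix.map_mul, hS']
    simp
  have hiso : ∀ a b : Fin (d + 2) → ℂ,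
      star ((S.map f)ᴴ *ᵥ a) ⬝ᵥ ((S.map f)ᴴ *ᵥ b) = star a ⬝ᵥ b := by
    intro a b
    rw [Matrix.star_mulVec, Matrix.conjTranspose_conjTranspose, ← Matrix.dotProduct_mulVec,
      Matrix.mulVec_mulVec, hSS, Matrix.one_mulVec]
  have huz : star u ⬝ᵥ z = ((∑ i, μvec i * Complex.normSq (w i) : ℝ) : ℂ) := by
    conv_lhs => rw [hzv, huw]
    rw [hiso, dotProduct]
    push_cast
    refine Finset.sum_congr rfl fun i _ => ?_
    rw [hvi, Complex.normSq_eq_conj_mul_self]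
    simp only [Pi.star_apply, Complex.star_def]
    ring
  have hzu : star z ⬝ᵥ u = ((∑ i, μvec i * Complex.normSq (w i) : ℝ) : ℂ) := by
    have h := congrArg star huz
    rw [Matrix.star_dotProduct, star_star] at h
    rw [dotProduct_comm] at h
    first
    | (rw [Complex.star_def, Complex.conj_ofReal] at h
       rw [← h, dotProduct_comm])
    | (rw [Complex.star_def, Complex.conj_ofReal] at h
       rw [← h])
  have hzz : star z ⬝ᵥ z = ((∑ i, μvec i ^ 2 * Complex.normSq (w i) : ℝ) : ℂ) := by
    rw [hzv, hiso, dotProduct]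
    push_cast
    refine Finset.sum_congr rfl fun i _ => ?_
    rw [Complex.normSq_eq_conj_mul_self]
    simp only [Pi.star_apply, Complex.star_def, hvi, map_mul, Complex.conj_ofReal]
    ring
  have hq : (star z ⬝ᵥ (J.map f *ᵥ z)).re = 0 := by
    have h : star (star z ⬝ᵥ (J.map f *ᵥ z)) = - (star z ⬝ᵥ (J.map f *ᵥ z)) := by
      have hneg' : (J.map f)ᴴ = - (J.map f) := by
        rw [hct, hJ]
        ext i j
        simp
      calc star (star z ⬝ᵥ (J.map f *ᵥ z)) = star (J.map f *ᵥ z) ⬝ᵥ z := by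
            rw [Matrix.star_dotProduct, star_star, dotProduct_comm]
        _ = _ := by
            rw [Matrix.star_mulVec, hneg', ← Matrix.dotProduct_mulVec, Matrix.neg_mulVec,
              dotProduct_neg]
    have h2 := congrArg Complex.re h
    rw [Complex.star_def, Complex.conj_re, Complex.neg_re] at h2
    linarith
  have hE : z + J.map f *ᵥ z = ((-μ : ℝ) : ℂ) • u := by
    rw [← heig, hAJ, add_mul, one_mul, Matrix.map_add f (by simp), Matrix.map_mul,
      Matrix.add_mulVec, ← Matrix.mulVec_mulVec]
  have hmain : ∑ i, μvec i ^ 2 * Complex.normSq (w i)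
      = -μ * ∑ i, μvec i * Complex.normSq (w i) := by
    have h := congrArg (fun x => (star z ⬝ᵥ x).re) hE
    simp only [dotProduct_add, dotProduct_smul, Complex.add_re, hq, hzz, hzu, smul_eq_mul,
      Complex.re_ofReal_mul, Complex.ofReal_re, add_zero] at h
    exact h
  have hpos' : ∀ i, i ≠ 0 → 0 < μvec i := by
    intro i hi
    refine lt_of_lt_of_le hpos (hmono.monotone ?_)
    rw [Fin.le_def]
    have : (i : ℕ) ≠ 0 := fun h => hi (Fin.ext h)
    simp
    omega
  have hne : ∀ i, μvec i ≠ 0 := by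
    intro i
    by_cases hi : i = 0
    · rw [hi]; exact hneg.ne
    · exact (hpos' i hi).ne'
  have hw0 : ∃ i, w i ≠ 0 := by
    by_contra! h
    apply hu
    rw [huw, show w = 0 from funext h, Matrix.mulVec_zero]
  have hN : 0 < ∑ i, μvec i ^ 2 * Complex.normSq (w i) := by
    obtain ⟨i, hi⟩ := hw0
    refine Finset.sum_pos' (fun j _ => mul_nonneg (sq_nonneg _) (Complex.normSq_nonneg _))
      ⟨i, Finset.mem_univ _, mul_pos (sq_pos_of_ne_zero (hne i)) (Complex.normSq_pos.mpr hi)⟩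
  have hQ : ∑ i, μvec i * Complex.normSq (w i) < 0 := by
    by_contra! h
    nlinarith [mul_nonneg hμ.le h]
  refine ⟨by rw [huz, Complex.ofReal_im], by rw [huz, Complex.ofReal_re]; exact hQ, ?_, ?_⟩
  · intro h0
    refine absurd hQ (not_lt.mpr (Finset.sum_nonneg fun i _ => ?_))
    by_cases hi : i = 0
    · rw [hi, h0]; simp
    · exact mul_nonneg (hpos' i hi).le (Complex.normSq_nonneg _)
  · have e : ∑ i, (-μvec i) * Complex.normSq (w i) = - ∑ i, μvec i * Complex.normSq (w i) := by
      rw [← Finset.sum_neg_distrib]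
      exact Finset.sum_congr rfl fun i _ => by ring
    rw [e, hmain, eq_div_iff (by linarith)]
    ring

end
end

section
/- Let 𝕃 be a d×d real symmetric matrix, J a d×d real antisymmetric matrix, μ ∈ ℝ, and u ∈ ℂ^d with (I+J)𝕃u = −μu. Then u*𝕃J𝕃u = 0 and (−μ)·(u*𝕃u) = ‖𝕃u‖². In particular u*𝕃u is real, and if μ > 0 and 𝕃u ≠ 0 then u*𝕃u < 0. -/
set_option autoImplicit false

open Matrix

noncomputable section

theorem star_quad_aux {d : ℕ} (M : Matrix (Fin d) (Fin d) ℂ) (u : Fin d → ℂ) :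
    star (star u ⬝ᵥ (M *ᵥ u)) = star u ⬝ᵥ (Mᴴ *ᵥ u) := by
  rw [← star_dotProduct_star, star_star, star_mulVec, dotProduct_comm, dotProduct_mulVec]
  rw [dotProduct_comm]

/-- Key algebraic identities for an eigenvector of `(I+J)𝕃`:
`u*𝕃J𝕃u = 0` and `(-μ)(u*𝕃u) = ‖𝕃u‖²`; in particular `u*𝕃u` is real, and it is
negative when `μ > 0` and `𝕃u ≠ 0`. -/
theorem nonreversible_eigenvector_identities
    {d : ℕ}
    (L J : Matrix (Fin d) (Fin d) ℝ) (hL : L.IsSymm) (hJ : Jᵀ = -J)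
    (μ : ℝ) (u : Fin d → ℂ)
    (heig : (((1 + J) * L).map (algebraMap ℝ ℂ)) *ᵥ u = ((-μ : ℝ) : ℂ) • u) :
    (star u) ⬝ᵥ (((L * J * L).map (algebraMap ℝ ℂ)) *ᵥ u) = 0 ∧
    ((-μ : ℝ) : ℂ) * ((star u) ⬝ᵥ ((L.map (algebraMap ℝ ℂ)) *ᵥ u)) =
      ((∑ i, Complex.normSq (((L.map (algebraMap ℝ ℂ)) *ᵥ u) i) : ℝ) : ℂ) ∧
    ((star u) ⬝ᵥ ((L.map (algebraMap ℝ ℂ)) *ᵥ u)).im = 0 ∧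
    (0 < μ → (L.map (algebraMap ℝ ℂ)) *ᵥ u ≠ 0 →
      ((star u) ⬝ᵥ ((L.map (algebraMap ℝ ℂ)) *ᵥ u)).re < 0) := by
  have mapH : ∀ M : Matrix (Fin d) (Fin d) ℝ,
      (M.map (algebraMap ℝ ℂ))ᴴ = Mᵀ.map (algebraMap ℝ ℂ) := by
    intro M
    ext i j
    simp [Matrix.conjTranspose_apply]
  have hLt : Lᵀ = L := hL
  have hAH : (L.map (algebraMap ℝ ℂ))ᴴ = L.map (algebraMap ℝ ℂ) := by rw [mapH, hLt]
  have hq := star_quad_aux (L.map (algebraMap ℝ ℂ)) u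
  rw [hAH] at hq
  have hp := star_quad_aux ((L * J * L).map (algebraMap ℝ ℂ)) u
  have hT : (L * J * L)ᵀ = -(L * J * L) := by
    rw [transpose_mul, transpose_mul, hLt, hJ]
    simp [Matrix.mul_assoc]
  have hneg : (-(L * J * L)).map (algebraMap ℝ ℂ) = -((L * J * L).map (algebraMap ℝ ℂ)) := by
    ext i j
    simp
  rw [mapH, hT, hneg, neg_mulVec, dotProduct_neg] at hp
  have hn : star u ⬝ᵥ (((L * L).map (algebraMap ℝ ℂ)) *ᵥ u) =
      ((∑ i, Complex.normSq (((L.map (algebraMap ℝ ℂ)) *ᵥ u) i) : ℝ) : ℂ) := by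
    rw [Matrix.map_mul, ← mulVec_mulVec, dotProduct_mulVec]
    nth_rewrite 1 [← hAH]
    rw [← star_mulVec]
    simp only [dotProduct, Pi.star_apply, Complex.ofReal_sum, Complex.normSq_eq_conj_mul_self]
    rfl
  have hsum : star u ⬝ᵥ (((L * L).map (algebraMap ℝ ℂ)) *ᵥ u) +
      star u ⬝ᵥ (((L * J * L).map (algebraMap ℝ ℂ)) *ᵥ u) =
      ((-μ : ℝ) : ℂ) * (star u ⬝ᵥ ((L.map (algebraMap ℝ ℂ)) *ᵥ u)) := by
    have h := congrArg (fun v => star u ⬝ᵥ ((L.map (algebraMap ℝ ℂ)) *ᵥ v)) heig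
    simp only [mulVec_mulVec, mulVec_smul, dotProduct_smul, smul_eq_mul] at h
    rw [← Matrix.map_mul] at h
    rw [← h, ← dotProduct_add, ← add_mulVec]
    congr 2
    have : L * ((1 + J) * L) = L * L + L * J * L := by noncomm_ring
    rw [this]
    ext i j
    simp
  rw [hn] at hsum
  generalize hS : (∑ i, Complex.normSq (((L.map (algebraMap ℝ ℂ)) *ᵥ u) i)) = S at *
  have hSpos : (L.map (algebraMap ℝ ℂ)) *ᵥ u ≠ 0 → 0 < S := by
    intro h0
    obtain ⟨i, hi⟩ := Function.ne_iff.mp h0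
    rw [← hS]
    exact Finset.sum_pos' (fun i _ => Complex.normSq_nonneg _)
      ⟨i, Finset.mem_univ _, Complex.normSq_pos.mpr hi⟩
  generalize star u ⬝ᵥ (((L * J * L).map (algebraMap ℝ ℂ)) *ᵥ u) = p at *
  generalize star u ⬝ᵥ ((L.map (algebraMap ℝ ℂ)) *ᵥ u) = q at *
  have hqi : q.im = 0 := Complex.conj_eq_iff_im.mp hq
  have hpr : p.re = 0 := by
    have := congrArg Complex.re hp
    simp at this
    linarith
  have hpi : p.im = 0 := by
    have := congrArg Complex.im hsum
    simpa [hqi] using this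
  have hp0 : p = 0 := Complex.ext hpr hpi
  rw [hp0, add_zero] at hsum
  refine ⟨hp0, hsum.symm, hqi, fun hμ h0 => ?_⟩
  have h1 := hSpos h0
  have h2 := congrArg Complex.re hsum
  simp at h2
  by_contra hc
  push Not at hc
  nlinarith [mul_nonneg hμ.le hc]

end
end

section
/- Let F : ℝ^d → ℝ be differentiable, and suppose that for all x ∈ ℝ^d, ⟨x, ∇F(x)⟩ ≥ m‖x‖² − b and F(x) ≤ (M/2)‖x‖² + B‖x‖ + A, where m, b, M, B, A > 0. Fix γ > 0 and β > 0, and set λ := min{1/8, m/(2M+γ²)} and Ā := (βm/(2M+γ²))·(B²/(2M+γ²) + (b/m)(M+γ²/2) + A). Then for all x ∈ ℝ^d: ⟨x, ∇F(x)⟩ ≥ 2λ·(F(x) + γ²‖x‖²/4) − 2Ā/β. -/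
set_option autoImplicit false

open scoped RealInnerProductSpace
open Gradient

noncomputable section

/-- The drift (Lyapunov) condition for the underdamped Langevin dynamics:
dissipativity plus quadratic growth imply `⟨x, ∇F(x)⟩ ≥ 2λ(F(x) + γ²‖x‖²/4) − 2Ā/β`. -/
theorem lyapunov_drift_condition
    {d : ℕ}
    (F : EuclideanSpace ℝ (Fin d) → ℝ) (hF : Differentiable ℝ F)
    (m b M B A γ β : ℝ)
    (hm : 0 < m) (hb : 0 < b) (hM : 0 < M) (hB : 0 < B) (hA : 0 < A)
    (hγ : 0 < γ) (hβ : 0 < β)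
    -- dissipativity: ⟨x, ∇F(x)⟩ ≥ m‖x‖² − b
    (hdiss : ∀ x, ⟪x, ∇ F x⟫ ≥ m * ‖x‖ ^ 2 - b)
    -- quadratic growth: F(x) ≤ (M/2)‖x‖² + B‖x‖ + A
    (hgrowth : ∀ x, F x ≤ M / 2 * ‖x‖ ^ 2 + B * ‖x‖ + A)
    (lam Abar : ℝ)
    (hlam : lam = min (1 / 8) (m / (2 * M + γ ^ 2)))
    (hAbar : Abar = β * m / (2 * M + γ ^ 2) *
      (B ^ 2 / (2 * M + γ ^ 2) + b / m * (M + γ ^ 2 / 2) + A)) :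
    ∀ x, ⟪x, ∇ F x⟫ ≥ 2 * lam * (F x + γ ^ 2 * ‖x‖ ^ 2 / 4) - 2 * Abar / β := by
  intro x
  have h1 := hdiss x
  have h2 := hgrowth x
  have hr : 0 ≤ ‖x‖ := norm_nonneg x
  generalize ‖x‖ = r at *
  generalize ⟪x, ∇ F x⟫ = g at *
  generalize F x = f at *
  obtain ⟨D, hD⟩ : ∃ D, D = 2 * M + γ ^ 2 := ⟨_, rfl⟩
  have hDp : 0 < D := by rw [hD]; positivity
  rw [← hD] at hlam hAbar
  have hk : lam ≤ m / D := hlam ▸ min_le_right _ _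
  have hl : 0 ≤ lam := by rw [hlam]; positivity
  have hA2 : 2 * Abar / β = 2 * (m / D) * (B ^ 2 / D + A) + b := by
    have e : M + γ ^ 2 / 2 = D / 2 := by rw [hD]; ring
    rw [hAbar, e]; field_simp
    ring
  have hU : f + γ ^ 2 * r ^ 2 / 4 ≤ D / 4 * r ^ 2 + B * r + A := by
    rw [hD]; linarith
  have hU0 : 0 ≤ D / 4 * r ^ 2 + B * r + A := by positivity
  have s1 : lam * (f + γ ^ 2 * r ^ 2 / 4) ≤ m / D * (D / 4 * r ^ 2 + B * r + A) :=
    (mul_le_mul_of_nonneg_left hU hl).trans (mul_le_mul_of_nonneg_right hk hU0)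
  have key : m * r ^ 2 - 2 * (m / D * (D / 4 * r ^ 2 + B * r + A))
      + 2 * (m / D) * (B ^ 2 / D + A) = m / (2 * D ^ 2) * (D * r - 2 * B) ^ 2 := by
    field_simp
    ring
  have hn : 0 ≤ m / (2 * D ^ 2) * (D * r - 2 * B) ^ 2 := by positivity
  rw [hA2]
  linarith

end
end
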